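/- The operator A is coercive on K_{g,h}(Ω,Ω'): for every fixed v ∈ K_{g,h}(Ω,Ω') there exists a constant c ≥ 1 (depending on n, p, s, Λ, Ω, Ω', g and v, but independent of u) such that for all u ∈ K_{g,h}(Ω,Ω'): ⟨Au − Av, u − v⟩ ≥ c^{−1}·‖u‖_{W^{s,p}(Ω')}^p − c·‖u‖_{W^{s,p}(Ω')}^{p−1} − c·‖u‖_{W^{s,p}(Ω')} − c. In particular, ⟨Au − Av, u − v⟩ / ‖u − v‖_{W^{s,p}(Ω')} → ∞ as ‖u‖_{W^{s,p}(Ω')} → ∞ with u ∈ K_{g,h}(Ω,Ω'). -/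

import Mathlib

open MeasureTheory Metric Filter
open scoped ENNReal Topology

noncomputable section

/-- `ℝ^n`. -/
abbrev Euc (n : ℕ) := EuclideanSpace ℝ (Fin n)

/-- `L(a,b) = |a-b|^{p-2}(a-b)` (real powers; the convention `L(a,a)=0` holds automatically). -/
noncomputable def Lf (p a b : ℝ) : ℝ := |a - b| ^ (p - 2) * (a - b)

/-- A symmetric measurable kernel of order `(s,p)` with ellipticity constant `Λ`. -/
def IsKernel (n : ℕ) (s p Λ : ℝ) (K : Euc n → Euc n → ℝ) : Prop :=
  Measurable (Function.uncurry K) ∧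
  (∀ x y, K x y = K y x) ∧ (∀ x y, 0 ≤ K x y) ∧
  (∀ᵐ z : Euc n × Euc n, Λ⁻¹ ≤ K z.1 z.2 * ‖z.1 - z.2‖ ^ ((n : ℝ) + s * p) ∧
    K z.1 z.2 * ‖z.1 - z.2‖ ^ ((n : ℝ) + s * p) ≤ Λ)

/-- Membership in the fractional Sobolev space `W^{s,p}(D)` (finiteness of the norm). -/
def MemW (n : ℕ) (s p : ℝ) (D : Set (Euc n)) (v : Euc n → ℝ) : Prop :=
  AEMeasurable v (volume.restrict D) ∧
  IntegrableOn (fun x => |v x| ^ p) D volume ∧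
  Integrable (fun q : Euc n × Euc n => |v q.1 - v q.2| ^ p / ‖q.1 - q.2‖ ^ ((n : ℝ) + s * p))
    ((volume.restrict D).prod (volume.restrict D))

/-- The `W^{s,p}(D)` norm. -/
noncomputable def sobNorm (n : ℕ) (s p : ℝ) (D : Set (Euc n)) (v : Euc n → ℝ) : ℝ :=
  (∫ x in D, |v x| ^ p) ^ (1/p) +
  (∫ x in D, ∫ y in D, |v x - v y| ^ p / ‖x - y‖ ^ ((n : ℝ) + s * p)) ^ (1/p)

/-- The nonlocal tail `Tail(f; z, r)`. -/
noncomputable def tailF (n : ℕ) (s p : ℝ) (f : Euc n → ℝ) (z : Euc n) (r : ℝ) : ℝ :=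
  (r ^ (s * p) * ∫ x in (ball z r)ᶜ, |f x| ^ (p - 1) * ‖x - z‖ ^ (-((n : ℝ) + s * p))) ^ (1/(p-1))

/-- Membership in the tail space `L^{p-1}_{sp}(ℝ^n)`. -/
def MemTail (n : ℕ) (s p : ℝ) (f : Euc n → ℝ) : Prop :=
  AEMeasurable f volume ∧
  (∀ z : Euc n, ∀ r : ℝ, 0 < r → IntegrableOn (fun x => |f x| ^ (p - 1)) (ball z r) volume) ∧
  (∀ z : Euc n, ∀ r : ℝ, 0 < r →
    IntegrableOn (fun x => |f x| ^ (p - 1) * ‖x - z‖ ^ (-((n : ℝ) + s * p))) (ball z r)ᶜ volume)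

/-- The admissible class `K_{g,h}(Ω,Ω')`. -/
def obstacleSet (n : ℕ) (s p : ℝ) (Ω Ω' : Set (Euc n)) (g : Euc n → ℝ) (h : Euc n → EReal) :
    Set (Euc n → ℝ) :=
  {u | MemW n s p Ω' u ∧ (∀ᵐ x ∂(volume : Measure (Euc n)), x ∈ Ω → h x ≤ (u x : EReal)) ∧
    (∀ᵐ x ∂(volume : Measure (Euc n)), x ∉ Ω → u x = g x)}

/-- The functional `A u (v)`. -/
noncomputable def Aop (n : ℕ) (p : ℝ) (Ω Ω' : Set (Euc n)) (g : Euc n → ℝ)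
    (K : Euc n → Euc n → ℝ) (u v : Euc n → ℝ) : ℝ :=
  (∫ x in Ω', ∫ y in Ω', Lf p (u x) (u y) * (v x - v y) * K x y) +
  2 * ∫ y in Ω'ᶜ, ∫ x in Ω, Lf p (u x) (g y) * v x * K x y

/-- `u` solves the obstacle problem in `K_{g,h}(Ω,Ω')`. -/
def SolvesObstacle (n : ℕ) (s p : ℝ) (Ω Ω' : Set (Euc n)) (g : Euc n → ℝ) (h : Euc n → EReal)
    (K : Euc n → Euc n → ℝ) (u : Euc n → ℝ) : Prop :=
  u ∈ obstacleSet n s p Ω Ω' g h ∧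
  ∀ v ∈ obstacleSet n s p Ω Ω' g h, 0 ≤ Aop n p Ω Ω' g K u (fun x => v x - u x)

/-- The essential oscillation of `f` on `A` (in `EReal`). -/
noncomputable def essOsc (n : ℕ) (A : Set (Euc n)) (f : Euc n → ℝ) : EReal :=
  essSup (fun x => (f x : EReal)) (volume.restrict A) -
    essInf (fun x => (f x : EReal)) (volume.restrict A)

end

namespace ACoer

lemma abs_rpow_mul (p : ℝ) (hp : 1 < p) (t : ℝ) (ht : 0 ≤ t) : t ^ (p - 2) * t = t ^ (p - 1) := by
  rcases ht.eq_or_lt with h | h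
  · subst h
    rw [mul_zero, Real.zero_rpow (by linarith)]
  · rw [← Real.rpow_add_one h.ne']
    congr 1
    ring

lemma rpow_mul_self (p : ℝ) (hp : 1 < p) (t : ℝ) (ht : 0 ≤ t) : t ^ (p - 1) * t = t ^ p := by
  rcases ht.eq_or_lt with h | h
  · subst h
    rw [mul_zero, Real.zero_rpow (by linarith)]
  · rw [← Real.rpow_add_one h.ne']
    congr 1
    ring

lemma abs_Lf (p : ℝ) (hp : 1 < p) (a b : ℝ) : |Lf p a b| = |a - b| ^ (p - 1) := by
  unfold Lf
  rw [abs_mul, abs_of_nonneg (Real.rpow_nonneg (abs_nonneg _) _),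
    abs_rpow_mul p hp _ (abs_nonneg _)]

lemma mono_aux (p : ℝ) (hp : 1 < p) (a b : ℝ) :
    (|a| ^ (p - 1) - |b| ^ (p - 1)) * (|a| - |b|) ≤
      (|a| ^ (p - 2) * a - |b| ^ (p - 2) * b) * (a - b) := by
  have ha := Real.rpow_nonneg (abs_nonneg a) (p - 2)
  have hb := Real.rpow_nonneg (abs_nonneg b) (p - 2)
  rw [← abs_rpow_mul p hp _ (abs_nonneg a), ← abs_rpow_mul p hp _ (abs_nonneg b)]
  have h1 : a * b ≤ |a| * |b| := by rw [← abs_mul]; exact le_abs_self _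
  have h2 := mul_le_mul_of_nonneg_left h1 ha
  have h3 := mul_le_mul_of_nonneg_left h1 hb
  have h4 : |a| * |a| = a * a := abs_mul_abs_self a
  have h5 : |b| * |b| = b * b := abs_mul_abs_self b
  nlinarith

lemma mono_nonneg (p : ℝ) (hp : 1 < p) (a b : ℝ) :
    0 ≤ (|a| ^ (p - 1) - |b| ^ (p - 1)) * (|a| - |b|) := by
  rcases le_total |a| |b| with h | h
  · have := Real.rpow_le_rpow (abs_nonneg a) h (by linarith : 0 ≤ p - 1)
    nlinarith
  · have := Real.rpow_le_rpow (abs_nonneg b) h (by linarith : 0 ≤ p - 1)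
    nlinarith

noncomputable def c0 (p : ℝ) : ℝ := (1 - (1 / 2) ^ (p - 1)) / 2

lemma c0_pos (p : ℝ) (hp : 1 < p) : 0 < c0 p := by
  have : ((1 : ℝ) / 2) ^ (p - 1) < 1 :=
    Real.rpow_lt_one (by norm_num) (by norm_num) (by linarith)
  unfold c0
  linarith

lemma mono_lower (p : ℝ) (hp : 1 < p) (a b : ℝ) :
    c0 p * |a| ^ p - c0 p * 2 ^ p * |b| ^ p ≤
      (|a| ^ (p - 2) * a - |b| ^ (p - 2) * b) * (a - b) := by
  refine le_trans ?_ (mono_aux p hp a b)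
  have hc := c0_pos p hp
  have hbp := Real.rpow_nonneg (abs_nonneg b) p
  have hap := Real.rpow_nonneg (abs_nonneg a) (p - 1)
  have h2p : (0 : ℝ) < 2 ^ p := Real.rpow_pos_of_pos (by norm_num) p
  rcases le_total |b| (1 / 2 * |a|) with h | h
  · have h1 : |b| ^ (p - 1) ≤ (1 / 2) ^ (p - 1) * |a| ^ (p - 1) := by
      rw [← Real.mul_rpow (by norm_num) (abs_nonneg a)]
      exact Real.rpow_le_rpow (abs_nonneg b) h (by linarith)
    have h2 : c0 p * |a| ^ p ≤ (|a| ^ (p - 1) - |b| ^ (p - 1)) * (|a| - |b|) := by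
      have e : c0 p * |a| ^ p = ((1 - (1 / 2) ^ (p - 1)) * |a| ^ (p - 1)) * (1 / 2 * |a|) := by
        rw [← rpow_mul_self p hp _ (abs_nonneg a)]
        unfold c0
        ring
      rw [e]
      have h4 : (0 : ℝ) ≤ 1 - (1 / 2) ^ (p - 1) := by unfold c0 at hc; linarith
      have h5 := abs_nonneg a
      apply mul_le_mul
      · linarith
      · linarith
      · positivity
      · have := mul_nonneg h4 hap
        linarith
    have : 0 ≤ c0 p * 2 ^ p * |b| ^ p := by positivity
    linarith
  · have h1 : |a| ^ p ≤ 2 ^ p * |b| ^ p := by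
      rw [← Real.mul_rpow (by norm_num) (abs_nonneg b)]
      exact Real.rpow_le_rpow (abs_nonneg a) (by linarith) (by linarith)
    have := mono_nonneg p hp a b
    nlinarith

lemma young (p : ℝ) (hp : 1 < p) (x y : ℝ) (hx : 0 ≤ x) (hy : 0 ≤ y) :
    x ^ (p - 1) * y ≤ x ^ p + y ^ p := by
  have h1 := Real.rpow_nonneg hx p
  have h2 := Real.rpow_nonneg hy p
  rcases le_total x y with h | h
  · have := Real.rpow_le_rpow hx h (by linarith : 0 ≤ p - 1)
    have := mul_le_mul_of_nonneg_right this hy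
    rw [rpow_mul_self p hp y hy] at this
    linarith
  · have := mul_le_mul_of_nonneg_left h (Real.rpow_nonneg hx (p - 1))
    rw [rpow_mul_self p hp x hx] at this
    linarith

lemma rpow_sub_le (q : ℝ) (hq : 0 ≤ q) (a b : ℝ) :
    |a - b| ^ q ≤ 2 ^ q * (|a| ^ q + |b| ^ q) := by
  have hab : |a - b| ≤ |a| + |b| := abs_sub a b
  have h1 := Real.rpow_nonneg (abs_nonneg a) q
  have h2 := Real.rpow_nonneg (abs_nonneg b) q
  have h3 : (0 : ℝ) ≤ 2 ^ q := Real.rpow_nonneg (by norm_num) q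
  rcases le_total |a| |b| with h | h
  · have := Real.rpow_le_rpow (abs_nonneg (a - b)) (by linarith : |a - b| ≤ 2 * |b|) hq
    rw [Real.mul_rpow (by norm_num) (abs_nonneg b)] at this
    nlinarith
  · have := Real.rpow_le_rpow (abs_nonneg (a - b)) (by linarith : |a - b| ≤ 2 * |a|) hq
    rw [Real.mul_rpow (by norm_num) (abs_nonneg a)] at this
    nlinarith

/-- The p-power of the seminorm, as an integral over the product. -/
noncomputable def semi (n : ℕ) (s p : ℝ) (D : Set (Euc n)) (v : Euc n → ℝ) : ℝ :=
  ∫ q : Euc n × Euc n, |v q.1 - v q.2| ^ p / ‖q.1 - q.2‖ ^ ((n : ℝ) + s * p)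
    ∂((volume.restrict D).prod (volume.restrict D))

noncomputable def lp (n : ℕ) (p : ℝ) (D : Set (Euc n)) (v : Euc n → ℝ) : ℝ := ∫ x in D, |v x| ^ p

lemma semi_nonneg (n : ℕ) (s p : ℝ) (D : Set (Euc n)) (v : Euc n → ℝ) : 0 ≤ semi n s p D v :=
  integral_nonneg fun q => by positivity

lemma lp_nonneg (n : ℕ) (p : ℝ) (D : Set (Euc n)) (v : Euc n → ℝ) : 0 ≤ lp n p D v :=
  integral_nonneg fun q => by positivity

lemma sobNorm_eq (n : ℕ) (s p : ℝ) (D : Set (Euc n)) (v : Euc n → ℝ) (hv : MemW n s p D v) :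
    sobNorm n s p D v = lp n p D v ^ (1 / p) + semi n s p D v ^ (1 / p) := by
  unfold sobNorm lp semi
  rw [integral_prod _ hv.2.2]

lemma memW_sub (n : ℕ) (s p : ℝ) (hp : 1 < p) (D : Set (Euc n)) (u v : Euc n → ℝ)
    (hu : MemW n s p D u) (hv : MemW n s p D v) :
    MemW n s p D (fun x => u x - v x) ∧
    lp n p D (fun x => u x - v x) ≤ 2 ^ p * (lp n p D u + lp n p D v) ∧
    semi n s p D (fun x => u x - v x) ≤ 2 ^ p * (semi n s p D u + semi n s p D v) := by
  have hm : AEMeasurable (fun x => u x - v x) (volume.restrict D) := hu.1.sub hv.1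
  have h1 : Integrable (fun x => 2 ^ p * (|u x| ^ p + |v x| ^ p)) (volume.restrict D) :=
    (Integrable.add hu.2.1 hv.2.1).const_mul _
  have h2 : Integrable (fun q : Euc n × Euc n =>
      2 ^ p * (|u q.1 - u q.2| ^ p / ‖q.1 - q.2‖ ^ ((n : ℝ) + s * p) +
        |v q.1 - v q.2| ^ p / ‖q.1 - q.2‖ ^ ((n : ℝ) + s * p)))
      ((volume.restrict D).prod (volume.restrict D)) :=
    (Integrable.add hu.2.2 hv.2.2).const_mul _
  have b1 : ∀ x, |u x - v x| ^ p ≤ 2 ^ p * (|u x| ^ p + |v x| ^ p) := fun x =>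
    rpow_sub_le p (by linarith) _ _
  have b2 : ∀ q : Euc n × Euc n,
      |(u q.1 - v q.1) - (u q.2 - v q.2)| ^ p / ‖q.1 - q.2‖ ^ ((n : ℝ) + s * p) ≤
      2 ^ p * (|u q.1 - u q.2| ^ p / ‖q.1 - q.2‖ ^ ((n : ℝ) + s * p) +
        |v q.1 - v q.2| ^ p / ‖q.1 - q.2‖ ^ ((n : ℝ) + s * p)) := fun q => by
    rw [← add_div, ← mul_div_assoc,
      show (u q.1 - v q.1) - (u q.2 - v q.2) = (u q.1 - u q.2) - (v q.1 - v q.2) by ring]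
    exact div_le_div_of_nonneg_right (rpow_sub_le p (by linarith) _ _) (by positivity)
  have i1 : Integrable (fun x => |u x - v x| ^ p) (volume.restrict D) := by
    refine h1.mono' ?_ (Eventually.of_forall fun x => ?_)
    · exact ((hm.abs).pow_const p).aestronglyMeasurable
    · rw [Real.norm_of_nonneg (by positivity)]
      exact b1 x
  have i2 : Integrable (fun q : Euc n × Euc n =>
      |(u q.1 - v q.1) - (u q.2 - v q.2)| ^ p / ‖q.1 - q.2‖ ^ ((n : ℝ) + s * p))
      ((volume.restrict D).prod (volume.restrict D)) := by
    refine h2.mono' ?_ (Eventually.of_forall fun x => ?_)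
    · have m1 : AEMeasurable (fun q : Euc n × Euc n => u q.1 - v q.1)
          ((volume.restrict D).prod (volume.restrict D)) := hm.comp_fst
      have m2 : AEMeasurable (fun q : Euc n × Euc n => u q.2 - v q.2)
          ((volume.restrict D).prod (volume.restrict D)) := hm.comp_snd
      exact (((m1.sub m2).abs.pow_const p).div
        (by fun_prop)).aestronglyMeasurable
    · rw [Real.norm_of_nonneg (by positivity)]
      exact b2 x
  refine ⟨⟨hm, i1, i2⟩, ?_, ?_⟩
  · unfold lp
    rw [← integral_add hu.2.1 hv.2.1, ← integral_const_mul]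
    exact integral_mono i1 h1 b1
  · unfold semi
    rw [← integral_add hu.2.2 hv.2.2, ← integral_const_mul]
    exact integral_mono i2 h2 b2

lemma poincare (n : ℕ) (s p : ℝ) (hn : 1 ≤ n) (hs0 : 0 < s) (hp : 1 < p)
    (Ω Ω' : Set (Euc n)) (hΩ'o : IsOpen Ω')
    (hΩ'b : Bornology.IsBounded Ω') (hΩΩ' : closure Ω ⊆ Ω') :
    ∃ C : ℝ, 0 ≤ C ∧ ∀ w : Euc n → ℝ, MemW n s p Ω' w →
      (∀ᵐ x ∂(volume : Measure (Euc n)), x ∉ Ω → w x = 0) →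
      lp n p Ω' w ≤ C * semi n s p Ω' w := by
  rcases Ω'.eq_empty_or_nonempty with he | hne
  · exact ⟨0, le_rfl, fun w _ _ => by simp [he, lp]⟩
  have : Nonempty (Fin n) := ⟨⟨0, hn⟩⟩
  set E := Ω' \ closure Ω with hE
  have hEo : IsOpen E := hΩ'o.sdiff isClosed_closure
  have hEne : E.Nonempty := by
    by_contra hcon
    rw [Set.not_nonempty_iff_eq_empty, hE, Set.sdiff_eq_empty] at hcon
    have heq : Ω' = closure Ω := hcon.antisymm hΩΩ'
    have hcl : IsClopen Ω' := ⟨heq ▸ isClosed_closure, hΩ'o⟩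
    have huniv : Ω' = Set.univ := hcl.eq_univ hne
    rw [huniv] at hΩ'b
    exact NormedSpace.unbounded_univ ℝ (Euc n) hΩ'b
  have hEsub : E ⊆ Ω' := Set.sdiff_subset
  have hEfin : volume E < ⊤ := (hΩ'b.subset hEsub).measure_lt_top
  have hEpos : 0 < volume.real E :=
    ENNReal.toReal_pos (hEo.measure_pos volume hEne).ne' hEfin.ne
  obtain ⟨d, hd⟩ := hΩ'b.exists_norm_le
  obtain ⟨x0, hx0⟩ := hne
  have hd0 : 0 ≤ d := (norm_nonneg _).trans (hd x0 hx0)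
  set α := (n : ℝ) + s * p with hα
  have hα0 : 0 < α := by positivity
  refine ⟨(2 * d) ^ α / volume.real E, by positivity, fun w hw hw0 => ?_⟩
  have hfin : IsFiniteMeasure (volume.restrict E) := ⟨by simpa using hEfin⟩
  have key : ∫ q : Euc n × Euc n, |w q.1| ^ p * 1
      ∂((volume.restrict Ω').prod (volume.restrict E)) ≤ (2 * d) ^ α * semi n s p Ω' w := by
    have hle : (volume.restrict Ω').prod (volume.restrict E) ≤
        (volume.restrict Ω').prod (volume.restrict Ω') := by
      rw [Measure.prod_restrict, Measure.prod_restrict]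
      exact Measure.restrict_mono (Set.prod_mono le_rfl hEsub) le_rfl
    have hi := hw.2.2
    calc _ ≤ ∫ q : Euc n × Euc n, (2 * d) ^ α * (|w q.1 - w q.2| ^ p / ‖q.1 - q.2‖ ^ α)
          ∂((volume.restrict Ω').prod (volume.restrict E)) := by
          refine integral_mono_ae ?_ ((hi.mono_measure hle).const_mul _) ?_
          · exact hw.2.1.mul_prod (integrable_const (1 : ℝ))
          · have e1 : ∀ᵐ q ∂((volume.restrict Ω').prod (volume.restrict E)), q.1 ∈ Ω' :=
              Measure.quasiMeasurePreserving_fst.ae (ae_restrict_mem hΩ'o.measurableSet)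
            have e2 : ∀ᵐ q ∂((volume.restrict Ω').prod (volume.restrict E)), q.2 ∈ E :=
              Measure.quasiMeasurePreserving_snd.ae (ae_restrict_mem hEo.measurableSet)
            have e3 : ∀ᵐ q ∂((volume.restrict Ω').prod (volume.restrict E)),
                q.2 ∉ Ω → w q.2 = 0 :=
              Measure.quasiMeasurePreserving_snd.ae (ae_restrict_of_ae hw0)
            filter_upwards [e1, e2, e3] with q h1 h2 h3
            have hw2 : w q.2 = 0 := h3 fun hc => h2.2 (subset_closure hc)
            have hdist : ‖q.1 - q.2‖ ≤ 2 * d := by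
              have := norm_sub_le q.1 q.2
              have := hd _ h1
              have := hd _ (hEsub h2)
              linarith
            simp only [hw2, sub_zero, mul_one]
            by_cases hq : q.1 = q.2
            · rw [hq, hw2, abs_zero, Real.zero_rpow (by linarith)]
              simp
            · have hpos : 0 < ‖q.1 - q.2‖ := norm_pos_iff.2 (sub_ne_zero.2 hq)
              have hpos' : 0 < ‖q.1 - q.2‖ ^ α := Real.rpow_pos_of_pos hpos α
              have hl := Real.rpow_le_rpow hpos.le hdist hα0.le
              rw [mul_div_assoc', le_div_iff₀ hpos', mul_comm]
              exact mul_le_mul_of_nonneg_right hl (by positivity)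
      _ ≤ _ := by
          rw [integral_const_mul]
          refine mul_le_mul_of_nonneg_left ?_ (by positivity)
          exact integral_mono_measure hle (Eventually.of_forall fun q => by positivity) hi
  rw [integral_prod_mul (fun x => |w x| ^ p) (fun _ => (1 : ℝ))] at key
  simp only [integral_const, smul_eq_mul, mul_one, measureReal_restrict_apply_univ] at key
  rw [div_mul_eq_mul_div, le_div_iff₀ hEpos]
  exact key


lemma kernel_ae (n : ℕ) (s p Λ : ℝ) (hn : 1 ≤ n) (hs0 : 0 < s) (hp : 1 < p) (hΛ : 1 ≤ Λ)
    (K : Euc n → Euc n → ℝ) (hK : IsKernel n s p Λ K) (A B : Set (Euc n)) :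
    ∀ᵐ q : Euc n × Euc n ∂((volume.restrict A).prod (volume.restrict B)),
      0 < ‖q.1 - q.2‖ ∧ Λ⁻¹ / ‖q.1 - q.2‖ ^ ((n : ℝ) + s * p) ≤ K q.1 q.2 ∧
        K q.1 q.2 ≤ Λ / ‖q.1 - q.2‖ ^ ((n : ℝ) + s * p) := by
  rw [Measure.prod_restrict]
  apply ae_restrict_of_ae
  have h := hK.2.2.2
  rw [Measure.volume_eq_prod] at h
  filter_upwards [h] with q hq
  have hα0 : 0 < (n : ℝ) + s * p := by positivity
  have hΛi : 0 < Λ⁻¹ := by positivity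
  have hne : ‖q.1 - q.2‖ ≠ 0 := by
    intro h0
    have := hq.1
    rw [h0, Real.zero_rpow hα0.ne', mul_zero] at this
    linarith
  have hpos : 0 < ‖q.1 - q.2‖ := lt_of_le_of_ne (norm_nonneg _) hne.symm
  have hpos' := Real.rpow_pos_of_pos hpos ((n : ℝ) + s * p)
  exact ⟨hpos, (div_le_iff₀ hpos').2 hq.1, (le_div_iff₀ hpos').2 hq.2⟩

lemma measurable_Lf (p : ℝ) : Measurable fun q : ℝ × ℝ => Lf p q.1 q.2 := by
  unfold Lf
  fun_prop

lemma int_first (n : ℕ) (s p Λ : ℝ) (hn : 1 ≤ n) (hs0 : 0 < s) (hp : 1 < p) (hΛ : 1 ≤ Λ)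
    (K : Euc n → Euc n → ℝ) (hK : IsKernel n s p Λ K) (D : Set (Euc n)) (u w : Euc n → ℝ)
    (hu : MemW n s p D u) (hw : MemW n s p D w) :
    Integrable (fun q : Euc n × Euc n => Lf p (u q.1) (u q.2) * (w q.1 - w q.2) * K q.1 q.2)
      ((volume.restrict D).prod (volume.restrict D)) := by
  refine ((Integrable.add hu.2.2 hw.2.2).const_mul Λ).mono' ?_ ?_
  · have m1 : AEMeasurable (fun q : Euc n × Euc n => u q.1)
      ((volume.restrict D).prod (volume.restrict D)) := hu.1.comp_fst
    have m2 : AEMeasurable (fun q : Euc n × Euc n => u q.2)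
      ((volume.restrict D).prod (volume.restrict D)) := hu.1.comp_snd
    have m3 : AEMeasurable (fun q : Euc n × Euc n => w q.1)
      ((volume.restrict D).prod (volume.restrict D)) := hw.1.comp_fst
    have m4 : AEMeasurable (fun q : Euc n × Euc n => w q.2)
      ((volume.restrict D).prod (volume.restrict D)) := hw.1.comp_snd
    have m5 : Measurable (fun q : Euc n × Euc n => K q.1 q.2) := hK.1
    exact ((((measurable_Lf p).comp_aemeasurable (m1.prodMk m2)).mul (m3.sub m4)).mul
      m5.aemeasurable).aestronglyMeasurable
  · filter_upwards [kernel_ae n s p Λ hn hs0 hp hΛ K hK D D] with q hq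
    have hpos' := Real.rpow_pos_of_pos hq.1 ((n : ℝ) + s * p)
    rw [Real.norm_eq_abs, abs_mul, abs_mul, abs_Lf p hp, abs_of_nonneg (hK.2.2.1 _ _)]
    have hy := young p hp |u q.1 - u q.2| |w q.1 - w q.2| (abs_nonneg _) (abs_nonneg _)
    calc _ ≤ (|u q.1 - u q.2| ^ p + |w q.1 - w q.2| ^ p) *
          (Λ / ‖q.1 - q.2‖ ^ ((n : ℝ) + s * p)) :=
          mul_le_mul hy hq.2.2 (hK.2.2.1 _ _) (by positivity)
      _ = _ := by
          simp only [Pi.add_apply]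
          ring

lemma tail_one (n : ℕ) (s p : ℝ) (hs0 : 0 < s) (hp : 1 < p) (z : Euc n) (δ : ℝ) (hδ : 0 < δ) :
    IntegrableOn (fun y : Euc n => ‖y - z‖ ^ (-((n : ℝ) + s * p))) (ball z δ)ᶜ volume := by
  have hα0 : 0 < (n : ℝ) + s * p := by positivity
  have h1 : Integrable (fun x : Euc n => (1 + ‖x‖) ^ (-((n : ℝ) + s * p))) volume := by
    apply integrable_one_add_norm
    have : 0 < s * p := by positivity
    simp [this]
  have h2 := (h1.comp_sub_right z).const_mul ((1 + 1 / δ) ^ ((n : ℝ) + s * p))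
  refine h2.integrableOn.mono' ?_ ?_
  · exact (by fun_prop : Measurable fun y : Euc n => ‖y - z‖ ^ (-((n : ℝ) + s * p))).aestronglyMeasurable
  · filter_upwards [ae_restrict_mem (isOpen_ball.measurableSet.compl)] with y hy
    have hy' : δ ≤ ‖y - z‖ := by simpa [dist_eq_norm] using hy
    have hy0 : 0 < ‖y - z‖ := hδ.trans_le hy'
    rw [Real.norm_of_nonneg (by positivity), Real.rpow_neg hy0.le,
      Real.rpow_neg (by positivity), ← div_eq_mul_inv, ← Real.div_rpow (by positivity)
      (by positivity), ← Real.inv_rpow hy0.le]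
    refine Real.rpow_le_rpow (by positivity) ?_ hα0.le
    rw [inv_eq_one_div, div_le_div_iff₀ hy0 (by positivity)]
    have : 1 ≤ 1 / δ * ‖y - z‖ := by
      rw [one_div, inv_mul_eq_div, le_div_iff₀ hδ]; linarith
    nlinarith

lemma int_second (n : ℕ) (s p Λ : ℝ) (hn : 1 ≤ n) (hs0 : 0 < s) (hp : 1 < p) (hΛ : 1 ≤ Λ)
    (K : Euc n → Euc n → ℝ) (hK : IsKernel n s p Λ K)
    (Ω Ω' : Set (Euc n)) (hΩo : IsOpen Ω) (hΩ'o : IsOpen Ω')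
    (hΩb : Bornology.IsBounded Ω) (hΩΩ' : closure Ω ⊆ Ω')
    (g : Euc n → ℝ) (hgt : MemTail n s p g) (u w : Euc n → ℝ)
    (hu : MemW n s p Ω' u) (hw : MemW n s p Ω' w) :
    Integrable (fun q : Euc n × Euc n => Lf p (u q.2) (g q.1) * w q.2 * K q.2 q.1)
      ((volume.restrict Ω'ᶜ).prod (volume.restrict Ω)) := by
  rcases Ω.eq_empty_or_nonempty with he | ⟨z, hz⟩
  · simp [he]
  have hsub : Ω ⊆ Ω' := subset_closure.trans hΩΩ'
  have hcomp : IsCompact (closure Ω) := hΩb.isCompact_closure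
  obtain ⟨δ, hδ, hδsub⟩ := hcomp.exists_thickening_subset_open hΩ'o hΩΩ'
  obtain ⟨d, hd⟩ := hΩb.exists_norm_le
  have hd0 : 0 ≤ d := (norm_nonneg _).trans (hd z hz)
  set α := (n : ℝ) + s * p with hα
  have hα0 : 0 < α := by positivity
  have hfar : ∀ x ∈ Ω, ∀ y ∈ Ω'ᶜ, δ ≤ ‖y - x‖ := by
    intro x hx y hy
    by_contra hc
    apply hy
    apply hδsub
    rw [Metric.mem_thickening_iff]
    exact ⟨x, subset_closure hx, by rw [dist_eq_norm]; linarith⟩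
  have hball : Ω'ᶜ ⊆ (ball z δ)ᶜ := by
    intro y hy hc
    have := hfar z hz y hy
    rw [mem_ball, dist_eq_norm] at hc
    linarith
  have t1 : IntegrableOn (fun y : Euc n => ‖y - z‖ ^ (-α)) Ω'ᶜ volume :=
    (tail_one n s p hs0 hp z δ hδ).mono_set hball
  have t2 : IntegrableOn (fun y : Euc n => |g y| ^ (p - 1) * ‖y - z‖ ^ (-α)) Ω'ᶜ volume :=
    (hgt.2.2 z δ hδ).mono_set hball
  have huΩ : AEMeasurable u (volume.restrict Ω) := hu.1.mono_set hsub
  have hwΩ : AEMeasurable w (volume.restrict Ω) := hw.1.mono_set hsub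
  have iu : IntegrableOn (fun x => |u x| ^ p) Ω volume := hu.2.1.mono_set hsub
  have iw : IntegrableOn (fun x => |w x| ^ p) Ω volume := hw.2.1.mono_set hsub
  have hfin : IsFiniteMeasure (volume.restrict Ω) := ⟨by simpa using hΩb.measure_lt_top⟩
  have j1 : Integrable (fun x => |u x| ^ (p - 1) * |w x|) (volume.restrict Ω) := by
    refine (Integrable.add iu iw).mono'
      ((huΩ.abs.pow_const _).mul hwΩ.abs).aestronglyMeasurable (Eventually.of_forall fun x => ?_)
    rw [Real.norm_of_nonneg (by positivity)]
    exact young p hp _ _ (abs_nonneg _) (abs_nonneg _)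
  have j2 : Integrable (fun x => |w x|) (volume.restrict Ω) := by
    refine (Integrable.add (integrable_const (1 : ℝ)) iw).mono'
      hwΩ.abs.aestronglyMeasurable (Eventually.of_forall fun x => ?_)
    rw [Real.norm_of_nonneg (by positivity)]
    have := young p hp 1 |w x| zero_le_one (abs_nonneg _)
    simpa using this
  have k1 := t1.mul_prod j1
  have k2 := t2.mul_prod j2
  refine ((k1.add k2).const_mul (2 ^ (p - 1) * (Λ * (1 + 2 * d / δ) ^ α))).mono' ?_ ?_
  · have m1 : AEMeasurable (fun q : Euc n × Euc n => u q.2)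
      ((volume.restrict Ω'ᶜ).prod (volume.restrict Ω)) := huΩ.comp_snd
    have m2 : AEMeasurable (fun q : Euc n × Euc n => g q.1)
      ((volume.restrict Ω'ᶜ).prod (volume.restrict Ω)) := hgt.1.restrict.comp_fst
    have m3 : AEMeasurable (fun q : Euc n × Euc n => w q.2)
      ((volume.restrict Ω'ᶜ).prod (volume.restrict Ω)) := hwΩ.comp_snd
    have m5 : Measurable (fun q : Euc n × Euc n => K q.2 q.1) := hK.1.comp measurable_swap
    exact ((((measurable_Lf p).comp_aemeasurable (m1.prodMk m2)).mul m3).mul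
      m5.aemeasurable).aestronglyMeasurable
  · have e1 : ∀ᵐ q ∂((volume.restrict Ω'ᶜ).prod (volume.restrict Ω)), q.1 ∈ Ω'ᶜ :=
      Measure.quasiMeasurePreserving_fst.ae (ae_restrict_mem hΩ'o.measurableSet.compl)
    have e2 : ∀ᵐ q ∂((volume.restrict Ω'ᶜ).prod (volume.restrict Ω)), q.2 ∈ Ω :=
      Measure.quasiMeasurePreserving_snd.ae (ae_restrict_mem hΩo.measurableSet)
    filter_upwards [kernel_ae n s p Λ hn hs0 hp hΛ K hK Ω'ᶜ Ω, e1, e2] with q hq h1 h2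
    rw [Real.norm_eq_abs, abs_mul, abs_mul, abs_Lf p hp, abs_of_nonneg (hK.2.2.1 _ _),
      hK.2.1 q.2 q.1]
    have hδx := hfar _ h2 _ h1
    have hz0 : 0 < ‖q.1 - z‖ := hδ.trans_le (hfar z hz _ h1)
    have hcmp : ‖q.1 - z‖ ≤ (1 + 2 * d / δ) * ‖q.1 - q.2‖ := by
      have a1 : ‖q.1 - z‖ ≤ ‖q.1 - q.2‖ + ‖q.2 - z‖ := norm_sub_le_norm_sub_add_norm_sub _ _ _
      have a2 := norm_sub_le q.2 z
      have a3 := hd _ h2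
      have a4 := hd _ hz
      have a5 : 2 * d ≤ 2 * d / δ * ‖q.1 - q.2‖ := by
        rw [div_mul_eq_mul_div, le_div_iff₀ hδ]
        exact mul_le_mul_of_nonneg_left hδx (by positivity)
      nlinarith
    have hKb : K q.1 q.2 ≤ Λ * (1 + 2 * d / δ) ^ α * ‖q.1 - z‖ ^ (-α) := by
      refine hq.2.2.trans ?_
      have := Real.rpow_le_rpow hz0.le hcmp hα0.le
      rw [Real.mul_rpow (by positivity) (by positivity)] at this
      rw [Real.rpow_neg hz0.le, ← div_eq_mul_inv, div_le_div_iff₀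
        (Real.rpow_pos_of_pos hq.1 _) (Real.rpow_pos_of_pos hz0 _), mul_assoc]
      exact mul_le_mul_of_nonneg_left this (by positivity)
    have hL := rpow_sub_le (p - 1) (by linarith) (u q.2) (g q.1)
    calc _ ≤ (2 ^ (p - 1) * (|u q.2| ^ (p - 1) + |g q.1| ^ (p - 1))) * |w q.2| *
          (Λ * (1 + 2 * d / δ) ^ α * ‖q.1 - z‖ ^ (-α)) :=
          mul_le_mul (mul_le_mul_of_nonneg_right hL (abs_nonneg _)) hKb (hK.2.2.1 _ _)
            (by positivity)
      _ = _ := by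
          simp only [Pi.add_apply]
          ring

lemma A_lower (n : ℕ) (s p Λ : ℝ) (hn : 1 ≤ n) (hs0 : 0 < s) (hp : 1 < p) (hΛ : 1 ≤ Λ)
    (K : Euc n → Euc n → ℝ) (hK : IsKernel n s p Λ K)
    (Ω Ω' : Set (Euc n)) (hΩo : IsOpen Ω) (hΩ'o : IsOpen Ω')
    (hΩb : Bornology.IsBounded Ω) (hΩΩ' : closure Ω ⊆ Ω')
    (g : Euc n → ℝ) (hgt : MemTail n s p g) (u v : Euc n → ℝ)
    (hu : MemW n s p Ω' u) (hv : MemW n s p Ω' v) :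
    c0 p * Λ⁻¹ * semi n s p Ω' u - c0 p * 2 ^ p * Λ * semi n s p Ω' v ≤
      Aop n p Ω Ω' g K u (fun x => u x - v x) - Aop n p Ω Ω' g K v (fun x => u x - v x) := by
  have hw := (memW_sub n s p hp Ω' u v hu hv).1
  have f1 := int_first n s p Λ hn hs0 hp hΛ K hK Ω' u _ hu hw
  have f2 := int_first n s p Λ hn hs0 hp hΛ K hK Ω' v _ hv hw
  have g1 := int_second n s p Λ hn hs0 hp hΛ K hK Ω Ω' hΩo hΩ'o hΩb hΩΩ' g hgt u _ hu hw
  have g2 := int_second n s p Λ hn hs0 hp hΛ K hK Ω Ω' hΩo hΩ'o hΩb hΩΩ' g hgt v _ hv hw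
  have hc := c0_pos p hp
  unfold Aop
  rw [← integral_prod _ f1, ← integral_prod _ f2, ← integral_prod _ g1, ← integral_prod _ g2]
  have hG : 0 ≤ (∫ q : Euc n × Euc n, Lf p (u q.2) (g q.1) * (u q.2 - v q.2) * K q.2 q.1
        ∂((volume.restrict Ω'ᶜ).prod (volume.restrict Ω))) -
      ∫ q : Euc n × Euc n, Lf p (v q.2) (g q.1) * (u q.2 - v q.2) * K q.2 q.1
        ∂((volume.restrict Ω'ᶜ).prod (volume.restrict Ω)) := by
    rw [← integral_sub g1 g2]
    refine integral_nonneg fun q => ?_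
    have := (mono_nonneg p hp (u q.2 - g q.1) (v q.2 - g q.1)).trans (mono_aux p hp _ _)
    have := mul_nonneg this (hK.2.2.1 q.2 q.1)
    refine this.trans_eq ?_
    simp only [Lf]
    ring
  have hF : c0 p * Λ⁻¹ * semi n s p Ω' u - c0 p * 2 ^ p * Λ * semi n s p Ω' v ≤
      (∫ q : Euc n × Euc n, Lf p (u q.1) (u q.2) * ((u q.1 - v q.1) - (u q.2 - v q.2)) * K q.1 q.2
        ∂((volume.restrict Ω').prod (volume.restrict Ω'))) -
      ∫ q : Euc n × Euc n, Lf p (v q.1) (v q.2) * ((u q.1 - v q.1) - (u q.2 - v q.2)) * K q.1 q.2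
        ∂((volume.restrict Ω').prod (volume.restrict Ω')) := by
    rw [← integral_sub f1 f2]
    unfold semi
    rw [← integral_const_mul, ← integral_const_mul,
      ← integral_sub (hu.2.2.const_mul _) (hv.2.2.const_mul _)]
    refine integral_mono_ae ((hu.2.2.const_mul _).sub (hv.2.2.const_mul _)) (f1.sub f2) ?_
    filter_upwards [kernel_ae n s p Λ hn hs0 hp hΛ K hK Ω' Ω'] with q hq
    have hm := mono_lower p hp (u q.1 - u q.2) (v q.1 - v q.2)
    have hm' := mul_le_mul_of_nonneg_right hm (hK.2.2.1 q.1 q.2)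
    have l1 := mul_le_mul_of_nonneg_left hq.2.1
      (by positivity : 0 ≤ c0 p * |u q.1 - u q.2| ^ p)
    have l2 := mul_le_mul_of_nonneg_left hq.2.2
      (by positivity : 0 ≤ c0 p * 2 ^ p * |v q.1 - v q.2| ^ p)
    have e1 : c0 p * Λ⁻¹ * (|u q.1 - u q.2| ^ p / ‖q.1 - q.2‖ ^ ((n : ℝ) + s * p)) =
      c0 p * |u q.1 - u q.2| ^ p * (Λ⁻¹ / ‖q.1 - q.2‖ ^ ((n : ℝ) + s * p)) := by ring
    have e2 : c0 p * 2 ^ p * Λ * (|v q.1 - v q.2| ^ p / ‖q.1 - q.2‖ ^ ((n : ℝ) + s * p)) =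
      c0 p * 2 ^ p * |v q.1 - v q.2| ^ p * (Λ / ‖q.1 - q.2‖ ^ ((n : ℝ) + s * p)) := by ring
    have e3 : Lf p (u q.1) (u q.2) * ((u q.1 - v q.1) - (u q.2 - v q.2)) * K q.1 q.2 -
        Lf p (v q.1) (v q.2) * ((u q.1 - v q.1) - (u q.2 - v q.2)) * K q.1 q.2 =
        (|u q.1 - u q.2| ^ (p - 2) * (u q.1 - u q.2) - |v q.1 - v q.2| ^ (p - 2) * (v q.1 - v q.2)) *
          (u q.1 - u q.2 - (v q.1 - v q.2)) * K q.1 q.2 := by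
      simp only [Lf]
      ring
    rw [e1, e2, e3]
    linarith
  linarith

/-- Sobolev norm of a difference. -/
lemma sobNorm_sub (n : ℕ) (s p : ℝ) (hp : 1 < p) (D : Set (Euc n)) (u v : Euc n → ℝ)
    (hu : MemW n s p D u) (hv : MemW n s p D v) :
    sobNorm n s p D (fun x => u x - v x) ≤ 2 * (sobNorm n s p D u + sobNorm n s p D v) := by
  obtain ⟨hw, h1, h2⟩ := memW_sub n s p hp D u v hu hv
  rw [sobNorm_eq _ _ _ _ _ hw, sobNorm_eq _ _ _ _ _ hu, sobNorm_eq _ _ _ _ _ hv]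
  have hp0 : 0 ≤ 1 / p := by positivity
  have hp1 : 1 / p ≤ 1 := by rw [div_le_one (by linarith)]; linarith
  have aux : ∀ a b c : ℝ, 0 ≤ a → 0 ≤ b → 0 ≤ c → c ≤ 2 ^ p * (a + b) →
      c ^ (1 / p) ≤ 2 * (a ^ (1 / p) + b ^ (1 / p)) := by
    intro a b c ha hb hc h
    have h3 := Real.rpow_le_rpow hc h hp0
    rw [Real.mul_rpow (by positivity) (by positivity), ← Real.rpow_mul (by norm_num),
      mul_one_div_cancel (by linarith), Real.rpow_one] at h3
    have h4 := Real.rpow_add_le_add_rpow ha hb hp0 hp1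
    linarith
  have k1 := aux _ _ _ (lp_nonneg n p D u) (lp_nonneg n p D v) (lp_nonneg n p D _) h1
  have k2 := aux _ _ _ (semi_nonneg n s p D u) (semi_nonneg n s p D v) (semi_nonneg n s p D _) h2
  linarith

lemma sobNorm_nonneg (n : ℕ) (s p : ℝ) (D : Set (Euc n)) (u : Euc n → ℝ)
    (hu : MemW n s p D u) : 0 ≤ sobNorm n s p D u := by
  rw [sobNorm_eq _ _ _ _ _ hu]
  have := lp_nonneg n p D u
  have := semi_nonneg n s p D u
  positivity

lemma sobNorm_rpow (n : ℕ) (s p : ℝ) (hp : 1 < p) (D : Set (Euc n)) (u : Euc n → ℝ)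
    (hu : MemW n s p D u) :
    sobNorm n s p D u ^ p ≤ 2 ^ p * (lp n p D u + semi n s p D u) := by
  rw [sobNorm_eq _ _ _ _ _ hu]
  have ha := lp_nonneg n p D u
  have hb := semi_nonneg n s p D u
  have ha' := Real.rpow_nonneg ha (1 / p)
  have hb' := Real.rpow_nonneg hb (1 / p)
  have := rpow_sub_le p (by linarith) (lp n p D u ^ (1 / p)) (-(semi n s p D u ^ (1 / p)))
  rw [sub_neg_eq_add, abs_neg, abs_of_nonneg ha', abs_of_nonneg hb',
    abs_of_nonneg (add_nonneg ha' hb'), ← Real.rpow_mul ha, ← Real.rpow_mul hb,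
    one_div_mul_cancel (by linarith), Real.rpow_one, Real.rpow_one] at this
  exact this

/-- The strong form: `⟨Au − Av, u − v⟩ ≥ c₁‖u‖^p − C₁`. -/
lemma strong (n : ℕ) (s p Λ : ℝ) (hn : 1 ≤ n) (hs0 : 0 < s) (hp : 1 < p) (hΛ : 1 ≤ Λ)
    (K : Euc n → Euc n → ℝ) (hK : IsKernel n s p Λ K)
    (Ω Ω' : Set (Euc n)) (hΩo : IsOpen Ω) (hΩ'o : IsOpen Ω')
    (hΩb : Bornology.IsBounded Ω) (hΩ'b : Bornology.IsBounded Ω') (hΩΩ' : closure Ω ⊆ Ω')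
    (g : Euc n → ℝ) (h : Euc n → EReal) (hgt : MemTail n s p g) (v : Euc n → ℝ)
    (hv : v ∈ obstacleSet n s p Ω Ω' g h) :
    ∃ c₁ C₁ : ℝ, 0 < c₁ ∧ 0 ≤ C₁ ∧ ∀ u ∈ obstacleSet n s p Ω Ω' g h,
      c₁ * sobNorm n s p Ω' u ^ p - C₁ ≤
        Aop n p Ω Ω' g K u (fun x => u x - v x) - Aop n p Ω Ω' g K v (fun x => u x - v x) := by
  obtain ⟨P, hP0, hP⟩ := poincare n s p hn hs0 hp Ω Ω' hΩ'o hΩ'b hΩΩ'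
  have hc := c0_pos p hp
  have hsv := semi_nonneg n s p Ω' v
  have hlv := lp_nonneg n p Ω' v
  have h2p : (0 : ℝ) < 2 ^ p := by positivity
  set T : ℝ := 2 ^ p with hT
  -- `‖u‖^p ≤ B₁ [u]^p + B₂`
  obtain ⟨B₁, B₂, hB₁, hB₂, hB⟩ : ∃ B₁ B₂ : ℝ, 0 < B₁ ∧ 0 ≤ B₂ ∧
      ∀ u ∈ obstacleSet n s p Ω Ω' g h,
        sobNorm n s p Ω' u ^ p ≤ B₁ * semi n s p Ω' u + B₂ := by
    refine ⟨T * (T * (P * T) + 1), T * (T * (P * (T * semi n s p Ω' v) + lp n p Ω' v)),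
      by positivity, by positivity, fun u hu => ?_⟩
    obtain ⟨hw, h1, h2⟩ := memW_sub n s p hp Ω' u v hu.1 hv.1
    have hw0 : ∀ᵐ x ∂(volume : Measure (Euc n)), x ∉ Ω → u x - v x = 0 := by
      filter_upwards [hu.2.2, hv.2.2] with x hx1 hx2 hx
      rw [hx1 hx, hx2 hx, sub_self]
    have h3 := hP _ hw hw0
    have h4 : lp n p Ω' u ≤ T * (lp n p Ω' (fun x => u x - v x) + lp n p Ω' v) := by
      have hvn : MemW n s p Ω' (fun x => -v x) := by
        refine ⟨hv.1.1.neg, by simpa using hv.1.2.1, ?_⟩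
        refine hv.1.2.2.congr (Eventually.of_forall fun q => ?_)
        simp only [neg_sub_neg]
        rw [abs_sub_comm]
      have := (memW_sub n s p hp Ω' _ _ hw hvn).2.1
      simpa [lp] using this
    have h5 := sobNorm_rpow n s p hp Ω' u hu.1
    have h6 := mul_le_mul_of_nonneg_left h2 hP0
    have h7 : lp n p Ω' u ≤ T * (P * (T * (semi n s p Ω' u + semi n s p Ω' v)) + lp n p Ω' v) :=
      h4.trans (mul_le_mul_of_nonneg_left (by linarith) h2p.le)
    calc _ ≤ _ := h5
      _ ≤ T * (T * (P * (T * (semi n s p Ω' u + semi n s p Ω' v)) + lp n p Ω' v) +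
          semi n s p Ω' u) := mul_le_mul_of_nonneg_left (by linarith) h2p.le
      _ = _ := by ring
  have hΛ0 : 0 < Λ := by linarith
  refine ⟨c0 p * Λ⁻¹ / B₁, c0 p * Λ⁻¹ / B₁ * B₂ + c0 p * T * Λ * semi n s p Ω' v,
    by positivity, by positivity, fun u hu => ?_⟩
  have h1 := A_lower n s p Λ hn hs0 hp hΛ K hK Ω Ω' hΩo hΩ'o hΩb hΩΩ' g hgt u v hu.1 hv.1
  refine le_trans ?_ h1
  have h2 := mul_le_mul_of_nonneg_left (hB u hu)
    (by positivity : 0 ≤ c0 p * Λ⁻¹ / B₁)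
  have h3 : c0 p * Λ⁻¹ / B₁ * (B₁ * semi n s p Ω' u + B₂) =
      c0 p * Λ⁻¹ * semi n s p Ω' u + c0 p * Λ⁻¹ / B₁ * B₂ := by
    field_simp
  linarith

end ACoer

/-- Lemma 3.4 (coercivity): for fixed `v ∈ K_{g,h}(Ω,Ω')` there is `c ≥ 1` with
`⟨Au − Av, u − v⟩ ≥ c⁻¹‖u‖^p − c‖u‖^{p−1} − c‖u‖ − c` for all `u ∈ K_{g,h}(Ω,Ω')`;
in particular `⟨Au − Av, u − v⟩ / ‖u − v‖ → ∞` as `‖u‖ → ∞` in `K_{g,h}(Ω,Ω')`. -/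
theorem A_coercive
    (n : ℕ) (s p Λ : ℝ) (hn : 1 ≤ n) (hs0 : 0 < s) (hs1 : s < 1) (hp : 1 < p)
    (hΛ : 1 ≤ Λ) (K : Euc n → Euc n → ℝ) (hK : IsKernel n s p Λ K)
    (Ω Ω' : Set (Euc n)) (hΩo : IsOpen Ω) (hΩ'o : IsOpen Ω')
    (hΩb : Bornology.IsBounded Ω) (hΩ'b : Bornology.IsBounded Ω') (hΩΩ' : closure Ω ⊆ Ω')
    (g : Euc n → ℝ) (h : Euc n → EReal)
    (hg : MemW n s p Ω' g) (hgt : MemTail n s p g)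
    (hne : (obstacleSet n s p Ω Ω' g h).Nonempty) :
    ∀ v ∈ obstacleSet n s p Ω Ω' g h, ∃ c : ℝ, 1 ≤ c ∧
      (∀ u ∈ obstacleSet n s p Ω Ω' g h,
        c⁻¹ * sobNorm n s p Ω' u ^ p - c * sobNorm n s p Ω' u ^ (p - 1)
            - c * sobNorm n s p Ω' u - c
          ≤ Aop n p Ω Ω' g K u (fun x => u x - v x)
              - Aop n p Ω Ω' g K v (fun x => u x - v x)) ∧
      (∀ C : ℝ, ∃ M : ℝ, ∀ u ∈ obstacleSet n s p Ω Ω' g h, M ≤ sobNorm n s p Ω' u →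
        C * sobNorm n s p Ω' (fun x => u x - v x)
          ≤ Aop n p Ω Ω' g K u (fun x => u x - v x)
              - Aop n p Ω Ω' g K v (fun x => u x - v x)) := by
  intro v hv
  obtain ⟨c₁, C₁, hc₁, hC₁, hmain⟩ := ACoer.strong n s p Λ hn hs0 hp hΛ K hK Ω Ω' hΩo hΩ'o
    hΩb hΩ'b hΩΩ' g h hgt v hv
  set c := max 1 (max c₁⁻¹ C₁) with hcdef
  have hc1 : 1 ≤ c := le_max_left _ _
  have hc2 : c₁⁻¹ ≤ c := (le_max_left _ _).trans (le_max_right _ _)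
  have hc3 : C₁ ≤ c := (le_max_right _ _).trans (le_max_right _ _)
  refine ⟨c, hc1, fun u hu => ?_, fun C => ?_⟩
  · refine le_trans ?_ (hmain u hu)
    have hN := ACoer.sobNorm_nonneg n s p Ω' u hu.1
    have h1 : c⁻¹ ≤ c₁ := inv_le_of_inv_le₀ hc₁ hc2
    have h2 := mul_le_mul_of_nonneg_right h1 (Real.rpow_nonneg hN p)
    have h3 : 0 ≤ c * sobNorm n s p Ω' u ^ (p - 1) :=
      mul_nonneg (by linarith) (Real.rpow_nonneg hN _)
    have h4 : 0 ≤ c * sobNorm n s p Ω' u := mul_nonneg (by linarith) hN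
    linarith
  · have hNv := ACoer.sobNorm_nonneg n s p Ω' v hv.1
    have ht : Tendsto (fun t : ℝ => t ^ (p - 1)) atTop atTop := tendsto_rpow_atTop (by linarith)
    obtain ⟨M, hM⟩ := (ht.eventually_ge_atTop ((2 * |C| + 1) / c₁)).exists_forall_of_atTop
    refine ⟨max M (C₁ + 2 * |C| * sobNorm n s p Ω' v), fun u hu hMu => ?_⟩
    refine le_trans ?_ (hmain u hu)
    have hN := ACoer.sobNorm_nonneg n s p Ω' u hu.1
    have hw := ACoer.sobNorm_nonneg n s p Ω' _ (ACoer.memW_sub n s p hp Ω' u v hu.1 hv.1).1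
    have h1 := hM _ ((le_max_left _ _).trans hMu)
    have h2 : C₁ + 2 * |C| * sobNorm n s p Ω' v ≤ sobNorm n s p Ω' u :=
      (le_max_right _ _).trans hMu
    have h3 := ACoer.sobNorm_sub n s p hp Ω' u v hu.1 hv.1
    have h4 := mul_le_mul_of_nonneg_left h3 (abs_nonneg C)
    have h5 := mul_le_mul_of_nonneg_right (le_abs_self C) hw
    rw [div_le_iff₀ hc₁] at h1
    have h6 := mul_le_mul_of_nonneg_right h1 hN
    rw [mul_right_comm, ACoer.rpow_mul_self p hp _ hN] at h6
    linarith
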